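/- arXiv:2507.18776 — 3 statements merged into one kernel-verified Lean document; each statement's English description precedes it below -/
import Mathlib

section
/- Let G be an r-regular simple graph on n vertices. Then for every vertex u, the K3-degree of u in the complement graph satisfies 2·K3deg_{Ḡ}(u) = 2·C(n-1, 2) − 3·r·(n − r − 1) − 2·K3deg_G(u), where C(n-1,2) is the binomial coefficient (n-1 choose 2). -/
/-- The `K₃`-degree (triangle-degree) of a vertex `v` in a finite simple graph `G`:
the number of triangles (3-cliques) of `G` containing `v`. -/
def K3deg {V : Type*} (G : SimpleGraph V) [Fintype V] [DecidableEq V] [DecidableRel G.Adj]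
    (v : V) : ℕ :=
  ((G.cliqueFinset 3).filter (fun t => v ∈ t)).card


lemma two_K3 {V : Type*} [Fintype V] [DecidableEq V] (G : SimpleGraph V) [DecidableRel G.Adj]
    (u : V) : (2 * K3deg G u : ℤ) = ∑ v, ∑ w, (if G.Adj u v then 1 else 0) *
      (if G.Adj v w then 1 else 0) * (if G.Adj u w then (1 : ℤ) else 0) := by
  have h1 : (Finset.univ.filter (fun p : V × V => G.Adj u p.1 ∧ G.Adj p.1 p.2 ∧ G.Adj u p.2)).card
      = 2 * K3deg G u := by
    rw [Finset.card_eq_sum_card_fiberwise (f := fun p : V × V => ({u, p.1, p.2} : Finset V))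
      (t := (G.cliqueFinset 3).filter (fun t => u ∈ t))]
    · rw [Finset.sum_const_nat (m := 2), K3deg, mul_comm]
      intro t ht
      simp only [Finset.mem_filter, SimpleGraph.mem_cliqueFinset_iff] at ht
      obtain ⟨htc, hut⟩ := ht
      have : (t.erase u).offDiag.card = 2 := by
        rw [Finset.offDiag_card, Finset.card_erase_of_mem hut, htc.card_eq]
      rw [← this]
      congr 1
      ext ⟨v, w⟩
      simp only [Finset.mem_filter, Finset.mem_univ, true_and, Finset.mem_offDiag,
        Finset.mem_erase]
      constructor
      · rintro ⟨⟨h1, h2, h3⟩, rfl⟩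
        simp [h1.ne', h2.ne, h3.ne']
      · rintro ⟨⟨h1, h2⟩, ⟨h3, h4⟩, h5⟩
        refine ⟨⟨htc.isClique hut h2 (Ne.symm h1), htc.isClique h2 h4 h5,
          htc.isClique hut h4 (Ne.symm h3)⟩, ?_⟩
        apply Finset.eq_of_subset_of_card_le
        · intro x hx
          simp only [Finset.mem_insert, Finset.mem_singleton] at hx
          rcases hx with rfl | rfl | rfl <;> assumption
        · rw [htc.card_eq, Finset.card_eq_three.2 ⟨u, v, w, Ne.symm h1, Ne.symm h3, h5, rfl⟩]
    · rintro ⟨v, w⟩ h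
      simp only [Finset.coe_filter, Finset.mem_univ, true_and, Set.mem_ofPred_eq] at h
      simp only [Finset.coe_filter, Set.mem_ofPred_eq, SimpleGraph.mem_cliqueFinset_iff]
      refine ⟨SimpleGraph.is3Clique_triple_iff.2 ⟨h.1, h.2.2, h.2.1⟩, by simp⟩
  have h2 : (2 * K3deg G u : ℤ) = ((2 * K3deg G u : ℕ) : ℤ) := by push_cast; rfl
  rw [h2, ← h1, Finset.card_filter, ← Finset.univ_product_univ, Finset.sum_product]
  push_cast
  refine Finset.sum_congr rfl fun v _ => Finset.sum_congr rfl fun w _ => ?_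
  by_cases a : G.Adj u v <;> by_cases b : G.Adj v w <;> by_cases c : G.Adj u w <;> simp [a, b, c]

lemma alg {V : Type*} [Fintype V] [DecidableEq V] (a b d : V → V → ℤ) (r : ℤ) (u : V)
    (hd : ∀ v w, d v w = if v = w then 1 else 0)
    (hb : ∀ v w, b v w = 1 - a v w - d v w) (hs : ∀ v w, a v w = a w v)
    (h0 : ∀ v, a v v = 0) (hi : ∀ v w, a v w * a v w = a v w)
    (hr : ∀ v, ∑ w, a v w = r) :
    ∑ v, ∑ w, b u v * b v w * b u w = ((Fintype.card V : ℤ) - 1) * (Fintype.card V - 2)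
      - 3 * r * (Fintype.card V - r - 1) - ∑ v, ∑ w, a u v * a v w * a u w := by
  have hr' : ∀ v, ∑ w, a w v = r := fun v => by simp_rw [fun w => hs w v]; exact hr v
  have hB : ∑ w, b u w = (Fintype.card V : ℤ) - 1 - r := by
    simp only [hb, Finset.sum_sub_distrib, hr, hd]
    simp; ring
  have hBB : ∀ v, b u v * b u v = b u v := by
    intro v
    rw [hb, hd]
    by_cases h : u = v
    · subst h; simp [h0]
    · simp only [h, if_false]; linear_combination hi u v
  -- inner sum
  have hin : ∀ v, ∑ w, a v w * b u w = r - ∑ w, a v w * a u w - a u v := by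
    intro v
    simp only [hb, mul_sub, Finset.sum_sub_distrib, hd, mul_one, hr]
    simp [hs u v]
  have hin2 : ∀ v, ∑ w, b v w * b u w
      = (Fintype.card V : ℤ) - 1 - r - (r - ∑ w, a v w * a u w - a u v) - b u v := by
    intro v
    rw [← hin, ← hB]
    have : ∑ w, d v w * b u w = b u v := by simp [hd]
    rw [← this, ← Finset.sum_sub_distrib, ← Finset.sum_sub_distrib]
    refine Finset.sum_congr rfl fun w _ => ?_
    rw [hb v w]; ring
  have hba : ∑ v, b u v * a u v = 0 := by
    refine Finset.sum_eq_zero fun v _ => ?_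
    rw [hb, hd]
    by_cases h : u = v
    · subst h; simp [h0]
    · simp only [h, if_false]; linear_combination - hi u v
  have hc : ∑ v, b u v * ∑ w, a v w * a u w
      = r * r - ∑ v, ∑ w, a u v * a v w * a u w - r := by
    have e1 : ∑ v, ∑ w, a v w * a u w = r * r := by
      rw [Finset.sum_comm]
      simp only [← Finset.sum_mul, hr', ← Finset.mul_sum, hr]
    have e2 : ∑ v, d u v * ∑ w, a v w * a u w = r := by
      simp [hd, hi, hr]
    have e3 : ∑ v, a u v * ∑ w, a v w * a u w = ∑ v, ∑ w, a u v * a v w * a u w := by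
      simp only [Finset.mul_sum, mul_assoc]
    rw [← e3]
    nth_rewrite 3 [← e2]
    rw [← e1, ← Finset.sum_sub_distrib, ← Finset.sum_sub_distrib]
    refine Finset.sum_congr rfl fun v _ => ?_
    rw [hb u v]; ring
  have key : ∑ v, ∑ w, b u v * b v w * b u w
      = ((Fintype.card V : ℤ) - 1 - r - r - 1) * ∑ v, b u v
        + ∑ v, b u v * ∑ w, a v w * a u w + ∑ v, b u v * a u v := by
    rw [Finset.mul_sum, ← Finset.sum_add_distrib, ← Finset.sum_add_distrib]
    refine Finset.sum_congr rfl fun v _ => ?_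
    simp only [mul_assoc]
    rw [← Finset.mul_sum, hin2]
    linear_combination - hBB v
  rw [key, hB, hc, hba]
  ring

theorem stmt0 {V : Type*} [Fintype V] [DecidableEq V] (G : SimpleGraph V) [DecidableRel G.Adj]
    (n r : ℕ) (hn : Fintype.card V = n) (hreg : G.IsRegularOfDegree r) (u : V) :
    (2 * K3deg Gᶜ u : ℤ) =
      2 * ((n - 1).choose 2 : ℤ) - 3 * r * ((n : ℤ) - r - 1) - 2 * K3deg G u := by
  have hch : 2 * ((n - 1).choose 2 : ℤ) = ((n : ℤ) - 1) * (n - 2) := by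
    have hpos : 0 < n := hn ▸ Fintype.card_pos_iff.2 ⟨u⟩
    obtain ⟨m, rfl⟩ : ∃ m, n = m + 1 := ⟨n - 1, by omega⟩
    have h3 : (m.choose 2 : ℚ) = m * (m - 1) / 2 := Nat.cast_choose_two ℚ m
    have h4 : (2 * (m.choose 2 : ℤ) : ℚ) = ((m : ℤ) * (m - 1) : ℚ) := by
      push_cast; rw [h3]; ring
    have h5 : 2 * (m.choose 2 : ℤ) = (m : ℤ) * (m - 1) := by exact_mod_cast h4
    simp only [Nat.add_sub_cancel]
    rw [h5]; push_cast; ring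
  rw [two_K3 Gᶜ u, two_K3 G u, hch, ← hn]
  refine alg (fun v w => if G.Adj v w then 1 else 0) (fun v w => if Gᶜ.Adj v w then 1 else 0)
    (fun v w => if v = w then 1 else 0) r u (fun _ _ => rfl) ?_ ?_ ?_ ?_ ?_
  · intro v w
    by_cases h : v = w
    · subst h; simp
    · by_cases h' : G.Adj v w <;> simp [h, h']
  · intro v w; simp [G.adj_comm]
  · intro v; simp
  · intro v w; simp
  · intro v
    rw [← hreg v, Finset.sum_boole, ← SimpleGraph.card_neighborFinset_eq_degree,
      SimpleGraph.neighborFinset_eq_filter]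
end

section
/- Let G be an r-regular K3-irregular simple graph. Then for every vertex v of G, the K3-degree of v satisfies K3deg(v) ≤ C(r, 2) − ⌈r/2⌉, where C(r,2) is the binomial coefficient (r choose 2). -/
theorem twin_le {V : Type*} [Fintype V] [DecidableEq V] (G : SimpleGraph V) [DecidableRel G.Adj]
    (u v : V) (h : ∀ w, w ≠ u → w ≠ v → (G.Adj u w ↔ G.Adj v w)) :
    K3deg G u ≤ K3deg G v := by
  have hadj : ∀ a b, G.Adj a b → G.Adj (Equiv.swap u v a) (Equiv.swap u v b) := by
    intro a b hab
    have hne := hab.ne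
    have h1 := h a
    have h2 := h b
    have s1 := hab.symm
    have c := G.adj_comm
    simp only [Equiv.swap_apply_def]
    split_ifs <;> grind
  unfold K3deg
  refine Finset.card_le_card_of_injOn (fun t => t.image (Equiv.swap u v)) ?_
    ((Finset.image_injective (Equiv.swap u v).injective).injOn)
  intro t ht
  simp only [Finset.coe_filter, SimpleGraph.mem_cliqueFinset_iff, Set.mem_setOf_eq] at ht ⊢
  obtain ⟨ht, hu⟩ := ht
  refine ⟨⟨?_, ?_⟩, ?_⟩
  · intro a ha b hb hab
    simp only [Finset.coe_image, Set.mem_image, Finset.mem_coe] at ha hb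
    obtain ⟨a, ha, rfl⟩ := ha
    obtain ⟨b, hb, rfl⟩ := hb
    exact hadj _ _ (ht.isClique ha hb (fun e => hab (by rw [e])))
  · rw [Finset.card_image_of_injective _ (Equiv.swap u v).injective]; exact ht.card_eq
  · exact Finset.mem_image.2 ⟨u, hu, by simp⟩

theorem two_mul_le {V : Type*} [Fintype V] [DecidableEq V] (G : SimpleGraph V) [DecidableRel G.Adj]
    (v : V) : K3deg G v * 2 ≤ ∑ u ∈ G.neighborFinset v,
      (G.neighborFinset u ∩ G.neighborFinset v).card := by
  have e := Finset.sum_card_bipartiteAbove_eq_sum_card_bipartiteBelow (fun (u : V) (t : Finset V) => u ∈ t)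
    (s := G.neighborFinset v) (t := (G.cliqueFinset 3).filter (fun t => v ∈ t))
  have h1 : ∑ t ∈ (G.cliqueFinset 3).filter (fun t => v ∈ t),
      ((G.neighborFinset v).bipartiteBelow (fun (u : V) (t : Finset V) => u ∈ t) t).card
      = K3deg G v * 2 := by
    unfold K3deg
    refine Finset.sum_const_nat ?_
    intro t ht
    simp only [Finset.mem_filter, SimpleGraph.mem_cliqueFinset_iff] at ht
    have : (G.neighborFinset v).bipartiteBelow (fun (u : V) (t : Finset V) => u ∈ t) t = t.erase v := by
      ext x
      simp only [Finset.mem_bipartiteBelow, SimpleGraph.mem_neighborFinset, Finset.mem_erase]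
      exact ⟨fun h => ⟨h.1.ne', h.2⟩, fun h => ⟨ht.1.isClique ht.2 h.2 (Ne.symm h.1), h.2⟩⟩
    rw [this, Finset.card_erase_of_mem ht.2, ht.1.card_eq]
  rw [← h1, ← e]
  refine Finset.sum_le_sum ?_
  intro u hu
  rw [SimpleGraph.mem_neighborFinset] at hu
  refine (Finset.card_le_card ?_).trans
    (Finset.card_image_le (f := fun w => ({v, u, w} : Finset V)))
  intro t ht
  simp only [Finset.mem_bipartiteAbove, Finset.mem_filter, SimpleGraph.mem_cliqueFinset_iff] at ht
  obtain ⟨⟨ht, hv⟩, hut⟩ := ht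
  have hc : ((t.erase v).erase u).card = 1 := by
    rw [Finset.card_erase_of_mem (Finset.mem_erase.2 ⟨hu.ne', hut⟩), Finset.card_erase_of_mem hv,
      ht.card_eq]
  obtain ⟨w, hw⟩ := Finset.card_eq_one.1 hc
  have hm : w ∈ (t.erase v).erase u := by simp [hw]
  simp only [Finset.mem_erase] at hm
  refine Finset.mem_image.2 ⟨w, ?_, ?_⟩
  · simp only [Finset.mem_inter, SimpleGraph.mem_neighborFinset]
    exact ⟨ht.isClique hut hm.2.2 hm.1.symm, ht.isClique hv hm.2.2 hm.2.1.symm⟩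
  · show insert v (insert u {w}) = t
    rw [← hw, Finset.insert_erase (Finset.mem_erase.2 ⟨hu.ne', hut⟩), Finset.insert_erase hv]

theorem stmt10 {V : Type*} [Fintype V] [DecidableEq V] (G : SimpleGraph V) [DecidableRel G.Adj]
    (r : ℕ) (hreg : G.IsRegularOfDegree r)
    (hirr : ∀ u w : V, K3deg G u = K3deg G w → u = w)
    (v : V) :
    (K3deg G v : ℤ) ≤ (r.choose 2 : ℤ) - ⌈(r : ℚ) / 2⌉ := by
  have key : ∀ u ∈ G.neighborFinset v,
      (G.neighborFinset u ∩ G.neighborFinset v).card + 2 ≤ r := by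
    intro u hu
    rw [SimpleGraph.mem_neighborFinset] at hu
    by_contra hlt
    have cu : (G.neighborFinset u).card = r := hreg u
    have cv : (G.neighborFinset v).card = r := hreg v
    have ceu : ((G.neighborFinset u).erase v).card = r - 1 := by
      rw [Finset.card_erase_of_mem (by simpa using hu.symm), cu]
    have cev : ((G.neighborFinset v).erase u).card = r - 1 := by
      rw [Finset.card_erase_of_mem (by simpa using hu), cv]
    have e1 : G.neighborFinset u ∩ G.neighborFinset v = (G.neighborFinset u).erase v := by
      refine Finset.eq_of_subset_of_card_le ?_ (by omega)
      intro x hx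
      simp only [Finset.mem_inter, SimpleGraph.mem_neighborFinset, Finset.mem_erase] at hx ⊢
      exact ⟨hx.2.ne', hx.1⟩
    have e2 : G.neighborFinset u ∩ G.neighborFinset v = (G.neighborFinset v).erase u := by
      refine Finset.eq_of_subset_of_card_le ?_ (by omega)
      intro x hx
      simp only [Finset.mem_inter, SimpleGraph.mem_neighborFinset, Finset.mem_erase] at hx ⊢
      exact ⟨hx.1.ne', hx.2⟩
    have hh : ∀ w, w ≠ u → w ≠ v → (G.Adj u w ↔ G.Adj v w) := by
      intro w h1 h2
      have := Finset.ext_iff.1 (e1.symm.trans e2) w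
      simpa [h1, h2] using this
    exact hu.ne (hirr _ _ (le_antisymm
      (twin_le G v u fun w h1 h2 => (hh w h2 h1).symm) (twin_le G u v hh)))
  have h2 := two_mul_le G v
  have h3 : ∑ u ∈ G.neighborFinset v, ((G.neighborFinset u ∩ G.neighborFinset v).card + 2)
      ≤ r * r := by
    refine (Finset.sum_le_card_nsmul _ _ r key).trans ?_
    rw [show (G.neighborFinset v).card = r from hreg v, smul_eq_mul]
  rw [Finset.sum_add_distrib, Finset.sum_const,
    show (G.neighborFinset v).card = r from hreg v, smul_eq_mul] at h3
  have h4 : (K3deg G v * 2 + r * 2 : ℚ) ≤ r * r := by exact_mod_cast (by omega)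
  have h5 : ⌈(r : ℚ) / 2⌉ ≤ (r.choose 2 : ℤ) - K3deg G v := by
    rw [Int.ceil_le]
    push_cast
    rw [Nat.cast_choose_two]
    linarith
  linarith
end

section
/- Let G be an r-regular K3-irregular simple graph on n vertices. Then, as an inequality of integers, (C(r,2) + nr/2 + 1) − (⌈r/2⌉ + ⌈(n − r − 1)/2⌉ + r²) ≥ n, where C(r,2) is the binomial coefficient (r choose 2) and nr/2 is an integer since G is r-regular on n vertices. -/
lemma K3_codeg {V : Type*} [Fintype V] [DecidableEq V]
    (G : SimpleGraph V) [DecidableRel G.Adj] (v u : V) (h : G.Adj v u) :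
    (((G.cliqueFinset 3).filter (fun t => v ∈ t)).filter (fun t => u ∈ t)).card
      = (G.neighborFinset u ∩ G.neighborFinset v).card := by
  symm
  apply Finset.card_bij (fun w _ => ({v, u, w} : Finset V))
  · intro w hw
    simp only [Finset.mem_inter, SimpleGraph.mem_neighborFinset] at hw
    simp only [Finset.mem_filter, SimpleGraph.mem_cliqueFinset_iff]
    refine ⟨⟨?_, by simp⟩, by simp⟩
    rw [SimpleGraph.is3Clique_triple_iff]
    exact ⟨h, hw.2, hw.1⟩
  · intro a ha b hb hab
    simp only [Finset.mem_inter, SimpleGraph.mem_neighborFinset] at ha hb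
    have : a ∈ ({v, u, b} : Finset V) := by rw [← hab]; simp
    simp only [Finset.mem_insert, Finset.mem_singleton] at this
    rcases this with h1 | h1 | h1
    · exact absurd h1 ha.2.ne'
    · exact absurd h1 ha.1.ne'
    · exact h1
  · intro t ht
    simp only [Finset.mem_filter, SimpleGraph.mem_cliqueFinset_iff] at ht
    obtain ⟨⟨ht, hv⟩, hu⟩ := ht
    have hc : ((t.erase v).erase u).card = 1 := by
      rw [Finset.card_erase_of_mem (Finset.mem_erase.2 ⟨h.ne', hu⟩),
        Finset.card_erase_of_mem hv, ht.card_eq]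
    obtain ⟨w, hw⟩ := Finset.card_eq_one.1 hc
    have hwm : w ∈ (t.erase v).erase u := by rw [hw]; simp
    simp only [Finset.mem_erase] at hwm
    refine ⟨w, ?_, ?_⟩
    · simp only [Finset.mem_inter, SimpleGraph.mem_neighborFinset]
      exact ⟨ht.isClique hu hwm.2.2 (Ne.symm hwm.1), ht.isClique hv hwm.2.2 (Ne.symm hwm.2.1)⟩
    · have : insert u ((t.erase v).erase u) = t.erase v :=
        Finset.insert_erase (Finset.mem_erase.2 ⟨h.ne', hu⟩)
      rw [hw] at this
      rw [this, Finset.insert_erase hv]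

lemma two_K3deg {V : Type*} [Fintype V] [DecidableEq V]
    (G : SimpleGraph V) [DecidableRel G.Adj] (v : V) :
    ∑ u ∈ G.neighborFinset v, (G.neighborFinset u ∩ G.neighborFinset v).card
      = 2 * K3deg G v := by
  rw [← Finset.sum_congr rfl (fun u hu => K3_codeg G v u (by simpa using hu))]
  simp_rw [Finset.card_filter _ ((G.cliqueFinset 3).filter (fun t => v ∈ t))]
  rw [Finset.sum_comm]
  simp_rw [← Finset.card_filter]
  rw [Finset.sum_congr rfl (g := fun _ => 2)]
  · rw [Finset.sum_const, K3deg, smul_eq_mul, mul_comm]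
  · intro t ht
    simp only [Finset.mem_filter, SimpleGraph.mem_cliqueFinset_iff] at ht
    obtain ⟨ht, hv⟩ := ht
    have : (G.neighborFinset v).filter (fun u => u ∈ t) = t.erase v := by
      ext u
      simp only [Finset.mem_filter, SimpleGraph.mem_neighborFinset, Finset.mem_erase]
      exact ⟨fun h => ⟨h.1.ne', h.2⟩, fun h => ⟨ht.isClique hv h.2 (Ne.symm h.1), h.2⟩⟩
    rw [this, Finset.card_erase_of_mem hv, ht.card_eq]

lemma sum_codeg {V : Type*} [Fintype V] [DecidableEq V]
    (G : SimpleGraph V) [DecidableRel G.Adj] (r : ℕ) (hreg : G.IsRegularOfDegree r) (v : V) :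
    ∑ u, (G.neighborFinset u ∩ G.neighborFinset v).card = r * r := by
  have h1 : ∀ u, (G.neighborFinset u ∩ G.neighborFinset v).card
      = ((G.neighborFinset v).filter (fun w => G.Adj u w)).card := by
    intro u; congr 1; ext w; simp [and_comm]
  simp_rw [h1, Finset.card_filter]
  rw [Finset.sum_comm]
  simp_rw [← Finset.card_filter]
  rw [Finset.sum_congr rfl (g := fun _ => r)]
  · rw [Finset.sum_const, G.card_neighborFinset_eq_degree, hreg v, smul_eq_mul]
  · intro w _
    rw [← hreg w, ← G.card_neighborFinset_eq_degree]
    congr 1; ext u; simp [G.adj_comm]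

lemma codeg_adj {V : Type*} [Fintype V] [DecidableEq V]
    (G : SimpleGraph V) [DecidableRel G.Adj] (r : ℕ) (hreg : G.IsRegularOfDegree r)
    (hirr : ∀ u w : V, K3deg G u = K3deg G w → u = w) (u v : V) (h : G.Adj u v) :
    (G.neighborFinset u ∩ G.neighborFinset v).card + 2 ≤ r := by
  by_contra hlt
  have hu : (G.neighborFinset u).card = r := hreg u
  have hv : (G.neighborFinset v).card = r := hreg v
  have e1 : ((G.neighborFinset u).erase v).card = r - 1 := by
    rw [Finset.card_erase_of_mem (by simpa using h), hu]
  have e2 : ((G.neighborFinset v).erase u).card = r - 1 := by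
    rw [Finset.card_erase_of_mem (by simpa using h.symm), hv]
  have s1 : G.neighborFinset u ∩ G.neighborFinset v = (G.neighborFinset u).erase v := by
    apply Finset.eq_of_subset_of_card_le
    · intro w; simp only [Finset.mem_inter, SimpleGraph.mem_neighborFinset, Finset.mem_erase]
      exact fun h => ⟨h.2.ne', h.1⟩
    · omega
  have s2 : G.neighborFinset u ∩ G.neighborFinset v = (G.neighborFinset v).erase u := by
    apply Finset.eq_of_subset_of_card_le
    · intro w; simp only [Finset.mem_inter, SimpleGraph.mem_neighborFinset, Finset.mem_erase]
      exact fun h => ⟨h.1.ne', h.2⟩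
    · omega
  have s3 := s1.symm.trans s2
  have key : ∀ w, w ≠ u → w ≠ v → (G.Adj u w ↔ G.Adj v w) := by
    intro w h1 h2
    have := Finset.ext_iff.1 s3 w
    simpa [h1, h2] using this
  refine h.ne (hirr u v ?_)
  have t1 := two_K3deg G u
  have t2 := two_K3deg G v
  have d1 : ∑ x ∈ G.neighborFinset u, (G.neighborFinset x ∩ G.neighborFinset u).card
      = ∑ x ∈ G.neighborFinset v, (G.neighborFinset x ∩ G.neighborFinset v).card := by
    rw [← Finset.add_sum_erase _ _ (show v ∈ G.neighborFinset u by simpa using h),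
      ← Finset.add_sum_erase _ _ (show u ∈ G.neighborFinset v by simpa using h.symm), s3,
      Finset.inter_comm]
    congr 1
    apply Finset.sum_congr rfl
    intro x hx
    rw [← s2] at hx
    simp only [Finset.mem_inter, SimpleGraph.mem_neighborFinset] at hx
    have f1 : (G.neighborFinset x ∩ G.neighborFinset u)
      = insert v ((G.neighborFinset x ∩ ((G.neighborFinset u).erase v))) := by
      rw [Finset.inter_erase, Finset.insert_erase]
      simpa using ⟨hx.2.symm, h⟩
    have f2 : (G.neighborFinset x ∩ G.neighborFinset v)
      = insert u ((G.neighborFinset x ∩ ((G.neighborFinset v).erase u))) := by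
      rw [Finset.inter_erase, Finset.insert_erase]
      simpa using ⟨hx.1.symm, h.symm⟩
    rw [f1, f2, Finset.card_insert_of_notMem (by simp), Finset.card_insert_of_notMem (by simp), s3]
  omega

lemma codeg_nadj {V : Type*} [Fintype V] [DecidableEq V]
    (G : SimpleGraph V) [DecidableRel G.Adj] (r : ℕ) (hreg : G.IsRegularOfDegree r)
    (hirr : ∀ u w : V, K3deg G u = K3deg G w → u = w) (u v : V) (h : u ≠ v) :
    (G.neighborFinset u ∩ G.neighborFinset v).card + 1 ≤ r := by
  by_contra hlt
  have hu : (G.neighborFinset u).card = r := hreg u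
  have hv : (G.neighborFinset v).card = r := hreg v
  have s1 : G.neighborFinset u ∩ G.neighborFinset v = G.neighborFinset u :=
    Finset.eq_of_subset_of_card_le Finset.inter_subset_left (by omega)
  have s2 : G.neighborFinset u ∩ G.neighborFinset v = G.neighborFinset v :=
    Finset.eq_of_subset_of_card_le Finset.inter_subset_right (by omega)
  have t1 := two_K3deg G u
  have t2 := two_K3deg G v
  rw [s1.symm.trans s2] at t1
  exact h (hirr u v (by omega))

theorem stmt13 {V : Type*} [Fintype V] [DecidableEq V] [Nonempty V]
    (G : SimpleGraph V) [DecidableRel G.Adj]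
    (n r : ℕ) (hn : Fintype.card V = n) (hreg : G.IsRegularOfDegree r)
    (hirr : ∀ u w : V, K3deg G u = K3deg G w → u = w) :
    (n : ℚ) ≤ ((r.choose 2 : ℚ) + (n : ℚ) * r / 2 + 1) -
      ((⌈(r : ℚ) / 2⌉ : ℚ) + (⌈((n : ℚ) - r - 1) / 2⌉ : ℚ) + (r : ℚ) ^ 2) := by
  have hm : n * r = 2 * G.edgeFinset.card := by
    rw [← G.sum_degrees_eq_twice_card_edges, Finset.sum_congr rfl (fun v _ => hreg v)]
    simp [hn]
  generalize G.edgeFinset.card = m at hm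
  have hmq : (n : ℚ) * r = 2 * m := by exact_mod_cast hm
  have hcq : (r.choose 2 : ℚ) = r * (r - 1) / 2 := Nat.cast_choose_two ℚ r
  -- upper bound
  have up : ∀ v, (K3deg G v : ℤ) ≤ (r.choose 2 : ℤ) - ⌈(r : ℚ) / 2⌉ := by
    intro v
    have h1 : ∑ u ∈ G.neighborFinset v, ((G.neighborFinset u ∩ G.neighborFinset v).card + 2)
        ≤ ∑ u ∈ G.neighborFinset v, r := Finset.sum_le_sum (fun u hu =>
          codeg_adj G r hreg hirr u v (by simpa [G.adj_comm] using hu))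
    rw [Finset.sum_add_distrib, two_K3deg, Finset.sum_const, Finset.sum_const,
      G.card_neighborFinset_eq_degree, hreg v, smul_eq_mul, smul_eq_mul] at h1
    have h2 : (2 : ℚ) * K3deg G v + r * 2 ≤ r * r := by exact_mod_cast h1
    have : ⌈(r : ℚ) / 2⌉ ≤ (r.choose 2 : ℤ) - (K3deg G v : ℤ) := by
      rw [Int.ceil_le]; push_cast; rw [hcq]; linarith
    linarith
  have lo : ∀ v, (r : ℤ) ^ 2 - m + ⌈((n : ℚ) - r - 1) / 2⌉ ≤ (K3deg G v : ℤ) := by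
    intro v
    have h0 := sum_codeg G r hreg v
    rw [← Finset.sum_add_sum_compl (insert v (G.neighborFinset v)),
      Finset.sum_insert (by simp), two_K3deg, Finset.inter_self,
      G.card_neighborFinset_eq_degree, hreg v] at h0
    have h1 : ∑ u ∈ (insert v (G.neighborFinset v))ᶜ,
        ((G.neighborFinset u ∩ G.neighborFinset v).card + 1)
        ≤ ∑ u ∈ (insert v (G.neighborFinset v))ᶜ, r := Finset.sum_le_sum (fun u hu =>
          codeg_nadj G r hreg hirr u v (by
            rintro rfl; simp at hu))
    have hc : ((insert v (G.neighborFinset v))ᶜ).card + (r + 1) = n := by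
      have := Finset.card_compl_add_card (insert v (G.neighborFinset v))
      rwa [Finset.card_insert_of_notMem (a := v) (by simp), G.card_neighborFinset_eq_degree,
        hreg v, hn] at this
    rw [Finset.sum_add_distrib, Finset.sum_const, Finset.sum_const, smul_eq_mul, smul_eq_mul] at h1
    generalize ((insert v (G.neighborFinset v))ᶜ).card = k at h1 hc
    generalize ∑ u ∈ (insert v (G.neighborFinset v))ᶜ, (G.neighborFinset u ∩ G.neighborFinset v).card = S at h0 h1
    have q0 : (r : ℚ) + 2 * K3deg G v + S = r * r := by exact_mod_cast h0
    have q1 : (S : ℚ) + k * 1 ≤ k * r := by exact_mod_cast h1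
    have q2 : (k : ℚ) = n - r - 1 := by
      have : (k : ℚ) + (r + 1) = n := by exact_mod_cast hc
      linarith
    have : ⌈((n : ℚ) - r - 1) / 2⌉ ≤ (K3deg G v : ℤ) - (r : ℤ) ^ 2 + m := by
      rw [Int.ceil_le]; push_cast
      rw [q2] at q1
      nlinarith
    linarith
  have hcard : n ≤ (Finset.Icc ((r : ℤ) ^ 2 - m + ⌈((n : ℚ) - r - 1) / 2⌉)
      ((r.choose 2 : ℤ) - ⌈(r : ℚ) / 2⌉)).card := by
    conv_lhs => rw [← hn, ← Finset.card_univ]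
    apply Finset.card_le_card_of_injOn (fun v => (K3deg G v : ℤ))
    · intro v _
      simpa using ⟨lo v, up v⟩
    · intro a _ b _ hab
      exact hirr a b (by simpa using hab)
  rw [Int.card_Icc] at hcard
  have v0 : V := Classical.arbitrary V
  have a1 := lo v0
  have a2 := up v0
  have fin : (n : ℤ) ≤ (r.choose 2 : ℤ) - ⌈(r : ℚ) / 2⌉ + 1
      - ((r : ℤ) ^ 2 - m + ⌈((n : ℚ) - r - 1) / 2⌉) := by omega
  have finq : (n : ℚ) ≤ (r.choose 2 : ℚ) - (⌈(r : ℚ) / 2⌉ : ℚ) + 1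
      - ((r : ℚ) ^ 2 - m + (⌈((n : ℚ) - r - 1) / 2⌉ : ℚ)) := by exact_mod_cast fin
  rw [hmq]
  linarith
end
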